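/- For all integers n, d, r with 2 ≤ n, 3 ≤ d, and 1 ≤ r ≤ d−1, the following binomial-coefficient identity holds: (n+r−1) · ( C(d+n−2, r−1)·C(d+n−r−2, n−1) + C(d+n−2, n+r−1)·C(r+n−2, r−1) ) = (2n+d−2) · C(n+d−2, r−1) · C(n+d−r−2, n−1). -/

import Mathlib

open Nat in
/-- Both sides equal `(a + m + e + 1)! / (a! * m! * e!)`. -/
theorem choose_mul_choose_hook (a m e : ℕ) :
    (m + a + 1) * ((a + m + e + 1).choose (m + a + 1) * (a + m).choose a) =
      (m + e + 1) * ((a + m + e + 1).choose a * (m + e).choose m) := by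
  have h₁ := Nat.choose_mul_factorial_mul_factorial (show m + a + 1 ≤ a + m + e + 1 by omega)
  have h₂ := Nat.choose_mul_factorial_mul_factorial (show a ≤ a + m by omega)
  have h₃ := Nat.choose_mul_factorial_mul_factorial (show a ≤ a + m + e + 1 by omega)
  have h₄ := Nat.choose_mul_factorial_mul_factorial (show m ≤ m + e by omega)
  rw [show a + m + e + 1 - (m + a + 1) = e by omega, Nat.factorial_succ (m + a),
    Nat.add_comm m a] at h₁
  rw [show a + m - a = m by omega] at h₂
  rw [show a + m + e + 1 - a = m + e + 1 by omega, Nat.factorial_succ (m + e)] at h₃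
  rw [show m + e - m = e by omega] at h₄
  rw [← h₂] at h₁
  rw [← h₄] at h₃
  rw [Nat.add_comm m a]
  have hpos : 0 < a ! * m ! * e ! := by positivity
  refine Nat.eq_of_mul_eq_mul_right hpos ?_
  linear_combination h₁ - h₃

/-- The binomial-coefficient identity expressing that the rank of the
`r`-th free module `B_r` (the sum of the ranks of the hook Weyl module `K_{r-1,n-1}` and
of the hook Schur module `L_{r-1,n}` on a free module of rank `d-1`) equals the
Herzog–Kühl Betti number `β_r` of a Gorenstein-linear resolution. -/
theorem statement9 (n d r : ℕ) (hn : 2 ≤ n) (hd : 3 ≤ d) (hr1 : 1 ≤ r) (hr2 : r ≤ d - 1) :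
    (n + r - 1) *
        (Nat.choose (d + n - 2) (r - 1) * Nat.choose (d + n - r - 2) (n - 1) +
          Nat.choose (d + n - 2) (n + r - 1) * Nat.choose (r + n - 2) (r - 1)) =
      (2 * n + d - 2) * Nat.choose (n + d - 2) (r - 1) * Nat.choose (n + d - r - 2) (n - 1) := by
  obtain ⟨a, rfl⟩ := Nat.exists_eq_add_of_le' hr1
  obtain ⟨m, rfl⟩ := Nat.exists_eq_add_of_le' (show 1 ≤ n by omega)
  obtain ⟨e, rfl⟩ := Nat.exists_eq_add_of_le (show a + 2 ≤ d by omega)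
  rw [show m + 1 + (a + 1) - 1 = m + a + 1 by omega,
    show a + 2 + e + (m + 1) - 2 = a + m + e + 1 by omega,
    show m + 1 + (a + 2 + e) - 2 = a + m + e + 1 by omega,
    show a + 2 + e + (m + 1) - (a + 1) - 2 = m + e by omega,
    show m + 1 + (a + 2 + e) - (a + 1) - 2 = m + e by omega,
    show a + 1 + (m + 1) - 2 = a + m by omega,
    show 2 * (m + 1) + (a + 2 + e) - 2 = 2 * m + a + e + 2 by omega,
    Nat.add_sub_cancel, Nat.add_sub_cancel]
  linear_combination choose_mul_choose_hook a m e
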